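/- Let E₁ and E₂ be finite-dimensional real inner product spaces, and let u (valued in E₁) and v (valued in E₂) be random variables with E[u] = 0, E[v] = 0, E[‖u‖²] < ∞, E[‖v‖²] < ∞. Let Γ_v := E[v ⊗ v] : E₂ → E₂ be invertible and Γ_{vu} := E[u ⊗ v] : E₂ → E₁, and set K* := Γ_{vu} ∘ Γ_v⁻¹. Then (i) E[(u - K* v) ⊗ v] = 0 (orthogonality of the optimal-gain residual), and (ii) for every linear map K : E₂ → E₁, E[‖u - K v‖²] = E[‖u - K* v‖²] + E[‖(K - K*) v‖²]; in particular K* minimizes E[‖u - K v‖²] over all linear maps K. -/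

import Mathlib

open MeasureTheory RealInnerProductSpace

/-- The outer product `a ⊗ b : E₂ →L[ℝ] E₁`, `x ↦ ⟨b, x⟩ a`, for `a : E₁`, `b : E₂`. -/
noncomputable def outerProd2 {E₁ E₂ : Type*} [NormedAddCommGroup E₁] [InnerProductSpace ℝ E₁]
    [NormedAddCommGroup E₂] [InnerProductSpace ℝ E₂] (a : E₁) (b : E₂) : E₂ →L[ℝ] E₁ :=
  (innerSL ℝ b).smulRight a

section OuterProduct

variable {Ω E₁ E₂ : Type*} [MeasurableSpace Ω] {μ : Measure Ω}
  [NormedAddCommGroup E₁] [InnerProductSpace ℝ E₁]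
  [NormedAddCommGroup E₂] [InnerProductSpace ℝ E₂]

lemma outerProd2_apply (a : E₁) (b x : E₂) : outerProd2 a b x = ⟪b, x⟫ • a := by
  simp [outerProd2]

lemma norm_outerProd2 (a : E₁) (b : E₂) : ‖outerProd2 a b‖ = ‖b‖ * ‖a‖ := by
  simp [outerProd2, ContinuousLinearMap.norm_smulRight_apply]

lemma outerProd2_sub_left (a a' : E₁) (b : E₂) :
    outerProd2 (a - a') b = outerProd2 a b - outerProd2 a' b := by
  ext x
  simp [outerProd2_apply, smul_sub]

lemma outerProd2_map_left {E₃ : Type*} [NormedAddCommGroup E₃] [InnerProductSpace ℝ E₃]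
    (L : E₃ →L[ℝ] E₁) (a : E₃) (b : E₂) :
    outerProd2 (L a) b = L.comp (outerProd2 a b) := by
  ext x
  simp [outerProd2_apply]

lemma continuous_outerProd2 :
    Continuous (fun p : E₁ × E₂ => outerProd2 p.1 p.2) :=
  ((ContinuousLinearMap.smulRightL ℝ E₂ E₁).continuous.comp
    ((innerSL ℝ).continuous.comp continuous_snd)).clm_apply continuous_fst

lemma MeasureTheory.MemLp.integrable_outerProd2 {w : Ω → E₁} {v : Ω → E₂}
    (hw : MemLp w 2 μ) (hv : MemLp v 2 μ) :
    Integrable (fun ω => outerProd2 (w ω) (v ω)) μ := by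
  refine (hv.norm.integrable_mul hw.norm).mono'
    (continuous_outerProd2.comp_aestronglyMeasurable
      (hw.aestronglyMeasurable.prodMk hv.aestronglyMeasurable)) ?_
  exact Filter.Eventually.of_forall fun ω => (norm_outerProd2 _ _).le

/-- The cross moment of `w` and `L v` is the Hilbert–Schmidt pairing of `E[w ⊗ v]` with `L`. -/
lemma integral_inner_map_eq_sum [CompleteSpace E₁] {ι : Type*} [Fintype ι]
    (e : OrthonormalBasis ι ℝ E₂) {w : Ω → E₁} {v : Ω → E₂}
    (hint : Integrable (fun ω => outerProd2 (w ω) (v ω)) μ) (L : E₂ →L[ℝ] E₁) :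
    ∫ ω, ⟪w ω, L (v ω)⟫ ∂μ =
      ∑ i, ⟪(∫ ω, outerProd2 (w ω) (v ω) ∂μ) (e i), L (e i)⟫ := by
  have hpt (ω : Ω) :
      ⟪w ω, L (v ω)⟫ = ∑ i, ⟪L (e i), outerProd2 (w ω) (v ω) (e i)⟫ := by
    conv_lhs => rw [← e.sum_repr' (v ω)]
    simp only [map_sum, map_smul, inner_sum, inner_smul_right, outerProd2_apply]
    refine Finset.sum_congr rfl fun i _ => ?_
    rw [real_inner_comm (v ω), real_inner_comm (w ω)]
  have hi (i : ι) : Integrable (fun ω => outerProd2 (w ω) (v ω) (e i)) μ :=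
    hint.apply_continuousLinearMap (e i)
  simp_rw [hpt]
  rw [integral_finsetSum _ fun i _ => (hi i).const_inner _]
  refine Finset.sum_congr rfl fun i _ => ?_
  rw [integral_inner (hi i), ContinuousLinearMap.integral_apply hint, real_inner_comm]

end OuterProduct

/-- **Optimal gain / orthogonality principle.** For centered square-integrable random
variables `u`, `v` with `Γ_v = E[v ⊗ v]` invertible, `Γ_vu = E[u ⊗ v]`, and
`K* = Γ_vu ∘ Γ_v⁻¹`: (i) `E[(u - K* v) ⊗ v] = 0`, and (ii) for every linear `K`,
`E[‖u - K v‖²] = E[‖u - K* v‖²] + E[‖(K - K*) v‖²]`; in particular `K*` minimizes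
`E[‖u - K v‖²]` over all linear maps `K`. -/
theorem stmt8 {Ω : Type*} [MeasurableSpace Ω] (μ : Measure Ω) [IsProbabilityMeasure μ]
    {E₁ E₂ : Type*} [NormedAddCommGroup E₁] [InnerProductSpace ℝ E₁] [FiniteDimensional ℝ E₁]
    [NormedAddCommGroup E₂] [InnerProductSpace ℝ E₂] [FiniteDimensional ℝ E₂]
    (u : Ω → E₁) (v : Ω → E₂)
    (hmu : AEStronglyMeasurable u μ) (hmv : AEStronglyMeasurable v μ)
    (hu0 : ∫ ω, u ω ∂μ = 0) (hv0 : ∫ ω, v ω ∂μ = 0)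
    (hu2 : Integrable (fun ω => ‖u ω‖ ^ 2) μ) (hv2 : Integrable (fun ω => ‖v ω‖ ^ 2) μ)
    (Γv : E₂ →L[ℝ] E₂) (hΓv : Γv = ∫ ω, outerProd2 (v ω) (v ω) ∂μ) (hΓvUnit : IsUnit Γv)
    (Γvu : E₂ →L[ℝ] E₁) (hΓvu : Γvu = ∫ ω, outerProd2 (u ω) (v ω) ∂μ)
    (Kstar : E₂ →L[ℝ] E₁) (hKstar : Kstar = Γvu.comp (Ring.inverse Γv)) :
    (∫ ω, outerProd2 (u ω - Kstar (v ω)) (v ω) ∂μ) = 0 ∧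
      ∀ K : E₂ →ₗ[ℝ] E₁,
        (∫ ω, ‖u ω - K (v ω)‖ ^ 2 ∂μ) =
            (∫ ω, ‖u ω - Kstar (v ω)‖ ^ 2 ∂μ) +
              ∫ ω, ‖(K - (Kstar : E₂ →ₗ[ℝ] E₁)) (v ω)‖ ^ 2 ∂μ ∧
          (∫ ω, ‖u ω - Kstar (v ω)‖ ^ 2 ∂μ) ≤ ∫ ω, ‖u ω - K (v ω)‖ ^ 2 ∂μ := by
  have : CompleteSpace E₁ := FiniteDimensional.complete ℝ E₁
  have : CompleteSpace E₂ := FiniteDimensional.complete ℝ E₂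
  have hu : MemLp u 2 μ := (memLp_two_iff_integrable_sq_norm hmu).2 hu2
  have hv : MemLp v 2 μ := (memLp_two_iff_integrable_sq_norm hmv).2 hv2
  have hmap (L : E₂ →L[ℝ] E₁) : MemLp (fun ω => L (v ω)) 2 μ := L.comp_memLp' hv
  have hres : MemLp (fun ω => u ω - Kstar (v ω)) 2 μ := hu.sub (hmap Kstar)
  have horth : ∫ ω, outerProd2 (u ω - Kstar (v ω)) (v ω) ∂μ = 0 := by
    have hcomp : ∫ ω, outerProd2 (Kstar (v ω)) (v ω) ∂μ = Kstar.comp Γv := by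
      simp_rw [outerProd2_map_left, hΓv]
      exact (ContinuousLinearMap.compL ℝ E₂ E₂ E₁ Kstar).integral_comp_comm
        (hv.integrable_outerProd2 hv)
    have hgain : Kstar.comp Γv = Γvu := by
      rw [hKstar, ContinuousLinearMap.comp_assoc]
      have : (Ring.inverse Γv).comp Γv = ContinuousLinearMap.id ℝ E₂ :=
        Ring.inverse_mul_cancel Γv hΓvUnit
      rw [this, ContinuousLinearMap.comp_id]
    simp_rw [outerProd2_sub_left]
    rw [integral_sub (hu.integrable_outerProd2 hv) ((hmap Kstar).integrable_outerProd2 hv),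
      hcomp, hgain, hΓvu, sub_self]
  refine ⟨horth, fun K => ?_⟩
  set L : E₂ →L[ℝ] E₁ := K.toContinuousLinearMap - Kstar with hL
  have hLapp (x : E₂) : (K - (Kstar : E₂ →ₗ[ℝ] E₁)) x = L x := by simp [hL]
  have hcross : ∫ ω, ⟪u ω - Kstar (v ω), L (v ω)⟫ ∂μ = 0 := by
    rw [integral_inner_map_eq_sum (stdOrthonormalBasis ℝ E₂) (hres.integrable_outerProd2 hv),
      horth]
    simp
  have hexp (ω : Ω) : ‖u ω - K (v ω)‖ ^ 2 =
      ‖u ω - Kstar (v ω)‖ ^ 2 - 2 * ⟪u ω - Kstar (v ω), L (v ω)⟫ + ‖L (v ω)‖ ^ 2 := by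
    rw [← norm_sub_sq_real]
    simp [hL]
  have hres2 : Integrable (fun ω => ‖u ω - Kstar (v ω)‖ ^ 2) μ :=
    hres.integrable_norm_pow two_ne_zero
  have hL2 : Integrable (fun ω => ‖L (v ω)‖ ^ 2) μ := (hmap L).integrable_norm_pow two_ne_zero
  have hinner : Integrable (fun ω => 2 * ⟪u ω - Kstar (v ω), L (v ω)⟫) μ :=
    (((hres.norm.integrable_mul (hmap L).norm).mono'
      (hres.aestronglyMeasurable.inner (hmap L).aestronglyMeasurable)
      (Filter.Eventually.of_forall fun ω => norm_inner_le_norm _ _))).const_mul 2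
  have hpyth : ∫ ω, ‖u ω - K (v ω)‖ ^ 2 ∂μ =
      (∫ ω, ‖u ω - Kstar (v ω)‖ ^ 2 ∂μ) + ∫ ω, ‖L (v ω)‖ ^ 2 ∂μ := by
    simp_rw [hexp]
    rw [integral_add (by exact hres2.sub hinner) hL2, integral_sub hres2 hinner, integral_const_mul,
      hcross, mul_zero, sub_zero]
  simp_rw [hLapp]
  refine ⟨hpyth, ?_⟩
  rw [hpyth]
  exact le_add_of_nonneg_right (integral_nonneg fun ω => sq_nonneg _)
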